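/- There exist a constant C > 0 and an integer n₀ such that for every integer n ≥ n₀, ldim(Q(n; 1, 2)) ≥ log log n − C · log log log n. -/

import Mathlib

open scoped Classical

namespace PaperLD

/-- A partial linear extension of a poset `α`: a duplicate-free list whose
listing order extends the partial order on the elements it contains. -/
structure PLE (α : Type*) [PartialOrder α] where
  toList : List α
  nodup : toList.Nodup
  le_imp : ∀ i j : Fin toList.length, toList.get i ≤ toList.get j → i ≤ j

/-- `x` occurs (weakly) before `y` in the partial linear extension `L`
(in particular both `x` and `y` belong to the ground set of `L`). -/
def PLE.Before {α : Type*} [PartialOrder α] (L : PLE α) (x y : α) : Prop :=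
  ∃ i j : Fin L.toList.length, i ≤ j ∧ L.toList.get i = x ∧ L.toList.get j = y

/-- A family of partial linear extensions is a local realiser if, for every
ordered pair `(x, y)` with `x ≱ y`, some member lists `x` before `y`. -/
def IsLocalRealiser {α : Type*} [PartialOrder α] {ι : Type*} (F : ι → PLE α) : Prop :=
  ∀ x y : α, ¬ y ≤ x → ∃ i, (F i).Before x y

/-- The multiplicity of `x` in a finite family of partial linear extensions:
the number of members whose ground set contains `x`. -/
noncomputable def mult {α : Type*} [PartialOrder α] {N : ℕ} (F : Fin N → PLE α) (x : α) : ℕ :=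
  (Finset.univ.filter fun i => x ∈ (F i).toList).card

/-- The local dimension of a finite poset: the least `d` such that there is a
local realiser in which every element has multiplicity at most `d`. -/
noncomputable def ldim (α : Type*) [PartialOrder α] [Fintype α] : ℕ :=
  sInf {d | ∃ (N : ℕ) (F : Fin N → PLE α), IsLocalRealiser F ∧ ∀ x : α, mult F x ≤ d}

/-- The order dimension of a finite poset: the least `d` such that some family of `d`
linear extensions (partial linear extensions containing every element) is a realiser. -/
noncomputable def odim (α : Type*) [PartialOrder α] [Fintype α] : ℕ :=
  sInf {d | ∃ F : Fin d → PLE α, (∀ i, ∀ x : α, x ∈ (F i).toList) ∧ IsLocalRealiser F}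

/-- `BoolLayers n ℓ k` is the suborder of the Boolean lattice `Q(n)` induced by the
`ℓ`-th and `k`-th layers: all subsets of an `n`-set of cardinality `ℓ` or `k`,
ordered by inclusion. -/
abbrev BoolLayers (n ℓ k : ℕ) := {s : Finset (Fin n) // s.card = ℓ ∨ s.card = k}

end PaperLD

namespace PaperLD

/-- If every subset of `V` on which `p` is strictly monotone has at most `m` elements, then
`V` has a labelling by `1, …, m` that increases along pairs on which `p` increases. -/
theorem exists_label_of_strictMonoOn_card_le {α β : Type*} [LinearOrder α] [LinearOrder β]
    (V : Finset α) (p : α → β) (m : ℕ)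
    (h : ∀ W ⊆ V, StrictMonoOn p (W : Set α) → W.card ≤ m) :
    ∃ f : α → ℕ, (∀ v ∈ V, f v ∈ Finset.Icc 1 m) ∧
      ∀ u ∈ V, ∀ v ∈ V, u < v → p u < p v → f u < f v := by
  let S : α → Finset (Finset α) := fun v =>
    V.powerset.filter fun W => StrictMonoOn p (W : Set α) ∧ v ∈ W ∧ ∀ w ∈ W, w ≤ v
  have hS : ∀ v W, W ∈ S v ↔
      W ⊆ V ∧ StrictMonoOn p (W : Set α) ∧ v ∈ W ∧ ∀ w ∈ W, w ≤ v := by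
    intro v W
    simp [S]
  have hsingle : ∀ v ∈ V, {v} ∈ S v := by
    intro v hv
    rw [hS]
    exact ⟨by simpa using hv, by simp, by simp, by simp⟩
  refine ⟨fun v => (S v).sup Finset.card, fun v hv => ?_, fun u hu v hv huv hp => ?_⟩
  · rw [Finset.mem_Icc]
    constructor
    · exact Finset.le_sup (f := Finset.card) (hsingle v hv)
    · exact Finset.sup_le fun W hW => h W ((hS v W).1 hW).1 ((hS v W).1 hW).2.1
  · obtain ⟨W, hW, hWc⟩ := Finset.exists_mem_eq_sup (S u) ⟨_, hsingle u hu⟩ Finset.card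
    obtain ⟨hWV, hWp, huW, hWu⟩ := (hS u W).1 hW
    have hvW : v ∉ W := fun hvW => (hWu v hvW).not_gt huv
    have hle : ∀ w ∈ W, p w ≤ p u := fun w hw => hWp.monotoneOn hw huW (hWu w hw)
    have hins : insert v W ∈ S v := by
      rw [hS]
      refine ⟨Finset.insert_subset hv hWV, ?_, Finset.mem_insert_self v W, ?_⟩
      · intro a ha b hb hab
        rw [Finset.mem_coe, Finset.mem_insert] at ha hb
        rcases ha with rfl | ha <;> rcases hb with rfl | hb
        · exact absurd hab (lt_irrefl _)
        · exact absurd (hab.trans_le (hWu b hb)) huv.not_gt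
        · exact (hle a ha).trans_lt hp
        · exact hWp ha hb hab
      · intro w hw
        rw [Finset.mem_insert] at hw
        rcases hw with rfl | hw
        · exact le_rfl
        · exact (hWu w hw).trans huv.le
    have hcard := Finset.le_sup (f := Finset.card) hins
    rw [Finset.card_insert_of_notMem hvW] at hcard
    change (S u).sup Finset.card < (S v).sup Finset.card
    omega

/-- The **Erdős–Szekeres theorem**: an injective map on more than `m * m` elements of a linear
order is strictly monotone or strictly antitone on more than `m` of them. -/
theorem erdos_szekeres {α β : Type*} [LinearOrder α] [LinearOrder β] (V : Finset α) (p : α → β)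
    (hp : Set.InjOn p (V : Set α)) (m : ℕ) (hm : m * m < V.card) :
    ∃ W ⊆ V, m < W.card ∧
      (StrictMonoOn p (W : Set α) ∨ StrictAntiOn p (W : Set α)) := by
  by_contra! hcon
  obtain ⟨f, hf, hf'⟩ := exists_label_of_strictMonoOn_card_le V p m fun W hW hWp =>
    not_lt.1 fun hlt => (hcon W hW hlt).1 hWp
  obtain ⟨g, hg, hg'⟩ := exists_label_of_strictMonoOn_card_le V (fun v => OrderDual.toDual (p v)) m
    fun W hW hWp => not_lt.1 fun hlt => (hcon W hW hlt).2 fun _ ha _ hb hab => hWp ha hb hab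
  obtain ⟨u, hu, v, hv, huv, heq⟩ := Finset.exists_ne_map_eq_of_card_lt_of_maps_to
    (s := V) (t := Finset.Icc 1 m ×ˢ Finset.Icc 1 m) (f := fun v => (f v, g v))
    (by simpa using hm) (fun v hv => Finset.mem_product.2 ⟨hf v hv, hg v hv⟩)
  rw [Prod.mk.injEq] at heq
  have key : ∀ u ∈ V, ∀ v ∈ V, u < v → f u = f v → g u = g v → False := by
    intro u hu v hv huv h1 h2
    rcases lt_trichotomy (p u) (p v) with h | h | h
    · exact (hf' u hu v hv huv h).ne h1
    · exact huv.ne (hp hu hv h)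
    · exact (hg' u hu v hv huv h).ne h2
  rcases lt_or_gt_of_ne huv with h | h
  · exact key u hu v hv h heq.1 heq.2
  · exact key v hv u hu h heq.1.symm heq.2.symm

section PLE

variable {α : Type*} [PartialOrder α]

/-- The position of `x` in the partial linear extension `L`. -/
noncomputable def PLE.pos (L : PLE α) (x : α) : ℕ := L.toList.idxOf x

theorem PLE.pos_injOn (L : PLE α) : Set.InjOn L.pos {x | x ∈ L.toList} :=
  fun _ hx _ _ hxy => (List.idxOf_inj hx).1 hxy

/-- The indices of the members of the family `F` whose ground set contains `x`. -/
noncomputable def indices {N : ℕ} (F : Fin N → PLE α) (x : α) : Finset (Fin N) :=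
  Finset.univ.filter fun i => x ∈ (F i).toList

theorem mem_indices {N : ℕ} {F : Fin N → PLE α} {x : α} {i : Fin N} :
    i ∈ indices F x ↔ x ∈ (F i).toList := by
  simp [indices]

theorem card_indices {N : ℕ} (F : Fin N → PLE α) (x : α) : (indices F x).card = mult F x := rfl

theorem PLE.before_iff (L : PLE α) (x y : α) :
    L.Before x y ↔
      x ∈ L.toList ∧ y ∈ L.toList ∧ L.pos x ≤ L.pos y := by
  constructor
  · rintro ⟨i, j, hij, rfl, rfl⟩
    refine ⟨List.get_mem _ _, List.get_mem _ _, ?_⟩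
    simpa [PLE.pos, L.nodup.idxOf_getElem] using hij
  · rintro ⟨hx, hy, h⟩
    exact ⟨⟨_, List.idxOf_lt_length_of_mem hx⟩, ⟨_, List.idxOf_lt_length_of_mem hy⟩, h,
      by simp, by simp⟩

theorem PLE.pos_le_of_le (L : PLE α) {x y : α} (hx : x ∈ L.toList) (hy : y ∈ L.toList)
    (hxy : x ≤ y) : L.pos x ≤ L.pos y :=
  L.le_imp ⟨_, List.idxOf_lt_length_of_mem hx⟩ ⟨_, List.idxOf_lt_length_of_mem hy⟩
    (by simpa using hxy)

/-- The partial linear extension listing `x` and then `y`. -/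
def PLE.pair (x y : α) (h : ¬ y ≤ x) : PLE α where
  toList := [x, y]
  nodup := by
    have : x ≠ y := fun hxy => h hxy.ge
    simpa using this
  le_imp := by
    intro i j hij
    fin_cases i <;> fin_cases j <;> simp_all

theorem PLE.pair_before (x y : α) (h : ¬ y ≤ x) : (PLE.pair x y h).Before x y :=
  ⟨⟨0, by simp [PLE.pair]⟩, ⟨1, by simp [PLE.pair]⟩, by simp, by simp [PLE.pair],
    by simp [PLE.pair]⟩

theorem exists_isLocalRealiser_mult_le_ldim (α : Type*) [PartialOrder α] [Fintype α] :
    ∃ (N : ℕ) (F : Fin N → PLE α), IsLocalRealiser F ∧ ∀ x : α, mult F x ≤ ldim α := by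
  refine Nat.sInf_mem (s := {d | ∃ (N : ℕ) (F : Fin N → PLE α), IsLocalRealiser F ∧
    ∀ x : α, mult F x ≤ d}) ?_
  let e := Fintype.equivFin {q : α × α // ¬ q.2 ≤ q.1}
  let F := fun i => PLE.pair (e.symm i).1.1 (e.symm i).1.2 (e.symm i).2
  refine ⟨Fintype.card {q : α × α // ¬ q.2 ≤ q.1}, _, F, fun x y hxy => ⟨e ⟨(x, y), hxy⟩, ?_⟩, fun x => ?_⟩
  · have := PLE.pair_before x y hxy
    simpa [F] using this
  · exact (Finset.card_filter_le _ _).trans (by simp)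

end PLE

/-- The singleton `{v}` as an element of the first two layers of the Boolean lattice. -/
def single {n : ℕ} (v : Fin n) : BoolLayers n 1 2 := ⟨{v}, Or.inl (by simp)⟩

/-- The pair `{a, c}` as an element of the first two layers of the Boolean lattice. -/
def doubleton {n : ℕ} (a c : Fin n) (h : a ≠ c) : BoolLayers n 1 2 :=
  ⟨{a, c}, Or.inr (Finset.card_pair h)⟩

theorem single_injective {n : ℕ} : Function.Injective (single (n := n)) := by
  intro u v h
  simpa [single] using h

/-- The members of the family `F` indexed by `K` all contain the singletons of elements of `V`,
each listing them in increasing or in decreasing order. -/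
def IsMonotoneFamily {n N : ℕ} (F : Fin N → PLE (BoolLayers n 1 2)) (K : Finset (Fin N))
    (V : Finset (Fin n)) : Prop :=
  ∀ i ∈ K, (∀ v ∈ V, single v ∈ (F i).toList) ∧
    (StrictMonoOn (fun v => (F i).pos (single v)) (V : Set (Fin n)) ∨
      StrictAntiOn (fun v => (F i).pos (single v)) (V : Set (Fin n)))

theorem IsMonotoneFamily.subset {n N : ℕ} {F : Fin N → PLE (BoolLayers n 1 2)}
    {K : Finset (Fin N)} {V W : Finset (Fin n)} (h : IsMonotoneFamily F K V) (hWV : W ⊆ V) :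
    IsMonotoneFamily F K W := fun i hi =>
  ⟨fun v hv => (h i hi).1 v (hWV hv),
    (h i hi).2.imp (fun hm => hm.mono (by exact_mod_cast hWV))
      fun hm => hm.mono (by exact_mod_cast hWV)⟩

/-- In a member of a monotone family, a pair never comes before the singleton of an element
lying strictly between its two elements. -/
theorem IsMonotoneFamily.notMem_of_before {n N : ℕ} {F : Fin N → PLE (BoolLayers n 1 2)}
    {K : Finset (Fin N)} {V : Finset (Fin n)} (h : IsMonotoneFamily F K V) {a b c : Fin n}
    (ha : a ∈ V) (hb : b ∈ V) (hc : c ∈ V) (hab : a < b) (hbc : b < c) {i : Fin N}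
    (hi : (F i).Before (doubleton a c (hab.trans hbc).ne) (single b)) : i ∉ K := by
  intro hiK
  obtain ⟨hV, hmono⟩ := h i hiK
  obtain ⟨hac, -, hle⟩ := (PLE.before_iff _ _ _).1 hi
  have h1 := (F i).pos_le_of_le (hV a ha) hac
    (show ({a} : Finset (Fin n)) ⊆ {a, c} by simp)
  have h2 := (F i).pos_le_of_le (hV c hc) hac
    (show ({c} : Finset (Fin n)) ⊆ {a, c} by simp)
  rcases hmono with hm | hm
  · exact (hm hb hc hbc).not_ge (h2.trans hle)
  · exact (hm ha hb hab).not_ge (h1.trans hle)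

theorem IsMonotoneFamily.exists_insert {n N d m : ℕ} {F : Fin N → PLE (BoolLayers n 1 2)}
    (hF : IsLocalRealiser F) (hd : ∀ x, mult F x ≤ d) {K : Finset (Fin N)}
    {V : Finset (Fin n)} (h : IsMonotoneFamily F K V) (hm : d * (m * m) + 2 < V.card) :
    ∃ i ∉ K, ∃ W ⊆ V, m < W.card ∧ IsMonotoneFamily F (insert i K) W := by
  have hne : V.Nonempty := Finset.card_pos.1 (by omega)
  set a := V.min' hne with ha
  set c := V.max' hne with hc
  have haV : a ∈ V := V.min'_mem hne
  have hcV : c ∈ V := V.max'_mem hne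
  have hac : a < c := V.min'_lt_max'_of_card (by omega)
  set B := (V.erase a).erase c with hB
  have hBV : ∀ b ∈ B, b ∈ V ∧ a < b ∧ b < c := by
    intro b hb
    rw [hB, Finset.mem_erase, Finset.mem_erase] at hb
    obtain ⟨hbc, hba, hb⟩ := hb
    exact ⟨hb, lt_of_le_of_ne (V.min'_le b hb) (Ne.symm hba), lt_of_le_of_ne (V.le_max' b hb) hbc⟩
  have hBcard : d * (m * m) < B.card := by
    rw [hB, Finset.card_erase_of_mem (Finset.mem_erase.2 ⟨hac.ne', hcV⟩),
      Finset.card_erase_of_mem haV]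
    omega
  have hex : ∀ b ∈ B, ∃ i, (F i).Before (doubleton a c hac.ne) (single b) := by
    intro b hb
    refine hF _ _ fun hle => ?_
    have : b ∈ ({a, c} : Finset (Fin n)) := hle (by simp [single])
    rw [Finset.mem_insert, Finset.mem_singleton] at this
    rcases this with h' | h'
    · exact (hBV b hb).2.1.ne' h'
    · exact (hBV b hb).2.2.ne h'
  have hNne : Nonempty (Fin N) := by
    obtain ⟨b, hb⟩ := Finset.card_pos.1 (Nat.zero_le _ |>.trans_lt hBcard)
    exact ⟨(hex b hb).choose⟩
  choose! g hg using hex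
  obtain ⟨i, -, hi⟩ := Finset.exists_lt_card_fiber_of_mul_lt_card_of_maps_to (s := B)
    (t := indices F (doubleton a c hac.ne)) (f := g) (n := m * m)
    (fun b hb => mem_indices.2 ((PLE.before_iff _ _ _).1 (hg b hb)).1)
    ((Nat.mul_le_mul_right _ (hd _)).trans_lt hBcard)
  have hfib : ∀ b ∈ B.filter (fun b => g b = i),
      b ∈ B ∧ (F i).Before (doubleton a c hac.ne) (single b) := by
    intro b hb
    obtain ⟨hbB, hgb⟩ := Finset.mem_filter.1 hb
    exact ⟨hbB, hgb ▸ hg b hbB⟩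
  have hmem : ∀ b ∈ B.filter (fun b => g b = i), single b ∈ (F i).toList := fun b hb =>
    ((PLE.before_iff _ _ _).1 (hfib b hb).2).2.1
  obtain ⟨W, hW, hWm, hWp⟩ := erdos_szekeres (B.filter fun b => g b = i)
    (fun v => (F i).pos (single v))
    (fun u hu v hv huv => single_injective ((F i).pos_injOn (hmem u hu) (hmem v hv) huv)) m hi
  have hWV : W ⊆ V := fun w hw => (hBV w (hfib w (hW hw)).1).1
  refine ⟨i, ?_, W, hWV, hWm, ?_⟩
  · obtain ⟨b, hb⟩ := Finset.card_pos.1 (Nat.zero_le _ |>.trans_lt hWm)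
    obtain ⟨hbB, hb'⟩ := hfib b (hW hb)
    exact h.notMem_of_before haV (hBV b hbB).1 hcV (hBV b hbB).2.1 (hBV b hbB).2.2 hb'
  · intro j hj
    rcases Finset.mem_insert.1 hj with rfl | hj
    · exact ⟨fun v hv => hmem v (hW hv), hWp⟩
    · exact h.subset hWV j hj

theorem IsMonotoneFamily.card_add_le {n N d : ℕ} {F : Fin N → PLE (BoolLayers n 1 2)}
    (hF : IsLocalRealiser F) (hd : ∀ x, mult F x ≤ d) (j : ℕ) :
    ∀ {K : Finset (Fin N)} {V : Finset (Fin n)}, IsMonotoneFamily F K V →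
      (d + 3) ^ (2 ^ j - 1) ≤ V.card → K.card + j ≤ d := by
  induction j with
  | zero =>
    intro K V h hV
    obtain ⟨v, hv⟩ := Finset.card_pos.1 (show 0 < V.card by simpa using hV)
    refine le_trans (Finset.card_le_card fun i hi => ?_) (hd (single v))
    exact mem_indices.2 ((h i hi).1 v hv)
  | succ j ih =>
    intro K V h hV
    set m := (d + 3) ^ (2 ^ j - 1) with hm
    have hm1 : 1 ≤ m := Nat.one_le_pow _ _ (by omega)
    have hpow : (d + 3) ^ (2 ^ (j + 1) - 1) = (d + 3) * (m * m) := by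
      have : 2 ^ (j + 1) - 1 = 1 + ((2 ^ j - 1) + (2 ^ j - 1)) := by
        have := Nat.one_le_two_pow (n := j)
        rw [pow_succ]
        omega
      rw [this, pow_add, pow_add, pow_one]
    obtain ⟨i, hi, W, -, hWm, hW⟩ := h.exists_insert hF hd (m := m) (by nlinarith)
    have := ih hW hWm.le
    rw [Finset.card_insert_of_notMem hi] at this
    omega

theorem lt_pow_ldim_boolLayers (n : ℕ) :
    n < (ldim (BoolLayers n 1 2) + 3) ^ 2 ^ (ldim (BoolLayers n 1 2) + 1) := by
  obtain ⟨N, F, hF, hd⟩ := exists_isLocalRealiser_mult_le_ldim (BoolLayers n 1 2)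
  generalize ldim (BoolLayers n 1 2) = d at hd ⊢
  by_contra! hn
  have := IsMonotoneFamily.card_add_le hF hd (d + 1) (K := ∅) (V := Finset.univ)
    (fun i hi => absurd hi (Finset.notMem_empty i))
    (by
      rw [Finset.card_univ, Fintype.card_fin]
      exact (Nat.pow_le_pow_right (by omega) (Nat.sub_le _ _)).trans hn)
  omega

theorem logb_logb_sub_le_of_lt_pow {n d : ℕ} (hn : 2 ^ 16 ≤ n)
    (h : n < (d + 3) ^ 2 ^ (d + 1)) :
    Real.logb 2 (Real.logb 2 n) - 3 * Real.logb 2 (Real.logb 2 (Real.logb 2 n)) ≤ d := by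
  have h2 : (1 : ℝ) < 2 := one_lt_two
  have hn' : (2 : ℝ) ^ (16 : ℝ) ≤ n := by exact_mod_cast hn
  have hn0 : (0 : ℝ) < n := lt_of_lt_of_le (by positivity) hn'
  have hw : 16 ≤ Real.logb 2 n := (Real.le_logb_iff_rpow_le h2 hn0).2 hn'
  have hx : 4 ≤ Real.logb 2 (Real.logb 2 n) := by
    rw [Real.le_logb_iff_rpow_le h2 (by linarith)]
    norm_num
    exact hw
  have hy : 2 ≤ Real.logb 2 (Real.logb 2 (Real.logb 2 n)) := by
    rw [Real.le_logb_iff_rpow_le h2 (by linarith)]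
    norm_num
    exact hx
  set w := Real.logb 2 n with hw_def
  set x := Real.logb 2 w with hx_def
  set y := Real.logb 2 x with hy_def
  by_cases hdx : x ≤ d
  · linarith
  push Not at hdx
  have hd0 : (0 : ℝ) ≤ d := Nat.cast_nonneg d
  have hlog : w ≤ 2 ^ (d + 1) * Real.logb 2 (d + 3) := by
    have : (n : ℝ) ≤ ((d : ℝ) + 3) ^ 2 ^ (d + 1) := by exact_mod_cast h.le
    have := Real.logb_le_logb_of_le h2 hn0 this
    rw [Real.logb_pow] at this
    exact_mod_cast this
  have hd3 : Real.logb 2 (d + 3) ≤ 2 * y := by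
    have : (d : ℝ) + 3 ≤ x ^ 2 := by nlinarith
    have := Real.logb_le_logb_of_le h2 (by linarith) this
    rw [Real.logb_pow] at this
    exact_mod_cast this
  have hw2 : w ≤ 2 ^ (d + 2) * y := by
    calc w ≤ 2 ^ (d + 1) * Real.logb 2 (d + 3) := hlog
      _ ≤ 2 ^ (d + 1) * (2 * y) := by gcongr
      _ = 2 ^ (d + 2) * y := by ring
  have hxle : x ≤ (d + 2) + Real.logb 2 y := by
    have := Real.logb_le_logb_of_le h2 (by linarith) hw2
    rw [Real.logb_mul (by positivity) (by linarith), Real.logb_pow,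
      Real.logb_self_eq_one h2] at this
    push_cast at this
    linarith
  have hylog : Real.logb 2 y ≤ y := by
    rw [Real.logb_le_iff_le_rpow h2 (by linarith)]
    have := one_add_mul_self_le_rpow_one_add (s := 1) (by norm_num) (show (1 : ℝ) ≤ y by linarith)
    norm_num at this
    linarith
  linarith

end PaperLD

open PaperLD

/-- There are `C > 0` and `n₀` such that for every `n ≥ n₀`,
`ldim(Q(n; 1, 2)) ≥ log log n − C·log log log n` (logs base 2). -/
theorem stmt9 :
    ∃ C : ℝ, 0 < C ∧ ∃ n₀ : ℕ, ∀ n : ℕ, n₀ ≤ n →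
      Real.logb 2 (Real.logb 2 n) -
          C * Real.logb 2 (Real.logb 2 (Real.logb 2 n)) ≤
        (ldim (BoolLayers n 1 2) : ℝ) := by
  exact ⟨3, by norm_num, 2 ^ 16, fun n hn =>
    logb_logb_sub_le_of_lt_pow hn (lt_pow_ldim_boolLayers n)⟩
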